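/- The endpoints of the solvability interval depend continuously on the forcing: if p₀ⁿ (n ∈ ℕ) and p₀ are continuous T-periodic functions with zero average over [0, T] and ‖p₀ⁿ − p₀‖∞ → 0 as n → ∞, then sup I(p₀ⁿ) → sup I(p₀) and inf I(p₀ⁿ) → inf I(p₀). -/

import Mathlib

open Real Set MeasureTheory

/-- The relativistic operator `φ(v) = v / √(1 - v²/c²)`. -/
noncomputable def phi (c v : ℝ) : ℝ := v / Real.sqrt (1 - v ^ 2 / c ^ 2)

/-- `x` is a `T`-periodic solution of the relativistic pendulum equation
`(φ(x'))' + a x' + b sin x = p`. -/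
def IsPendSol (c a b T : ℝ) (p x : ℝ → ℝ) : Prop :=
  Function.Periodic x T ∧
  ContDiff ℝ 1 x ∧
  (∀ t : ℝ, |deriv x t| < c) ∧
  ContDiff ℝ 1 (fun t : ℝ => phi c (deriv x t)) ∧
  ∀ t : ℝ, deriv (fun τ : ℝ => phi c (deriv x τ)) t + a * deriv x t + b * Real.sin (x t) = p t

/-- The solvability set `I(p₀)`: the values `s` for which the relativistic pendulum
equation with forcing `p₀ + s` has a `T`-periodic solution. -/
def solvSet (c a b T : ℝ) (p₀ : ℝ → ℝ) : Set ℝ :=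
  {s : ℝ | ∃ x : ℝ → ℝ, IsPendSol c a b T (fun t => p₀ t + s) x}


noncomputable def psi (c y : ℝ) : ℝ := y / Real.sqrt (1 + y ^ 2 / c ^ 2)

lemma psi_zero (c : ℝ) : psi c 0 = 0 := by simp [psi]

lemma psi_arg_pos (c y : ℝ) : 0 < 1 + y ^ 2 / c ^ 2 := by positivity

lemma psi_hasDerivAt (c y : ℝ) :
    HasDerivAt (psi c) (1 / (Real.sqrt (1 + y ^ 2 / c ^ 2)) ^ 3) y := by
  have h0 := psi_arg_pos c y
  have h1 : HasDerivAt (fun y : ℝ => 1 + y ^ 2 / c ^ 2) (2 * y / c ^ 2) y := by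
    have := ((hasDerivAt_pow 2 y).div_const (c ^ 2)).const_add 1
    simpa using this
  have h2 := h1.sqrt h0.ne'
  have h3 := (hasDerivAt_id y).div h2 (Real.sqrt_pos.2 h0).ne'
  have hs := Real.sq_sqrt h0.le
  have hp := Real.sqrt_pos.2 h0
  refine h3.congr_deriv ?_
  simp only [id]
  set r := Real.sqrt (1 + y ^ 2 / c ^ 2)
  have : (1 * r - y * (2 * y / c ^ 2 / (2 * r))) / r ^ 2 = (r ^ 2 - y ^ 2 / c ^ 2) / r ^ 3 := by
    field_simp
  rw [this, hs]; ring

lemma psi_deriv (c y : ℝ) : deriv (psi c) y = 1 / (Real.sqrt (1 + y ^ 2 / c ^ 2)) ^ 3 :=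
  (psi_hasDerivAt c y).deriv

lemma psi_continuous (c : ℝ) : Continuous (psi c) :=
  continuous_iff_continuousAt.2 fun y => (psi_hasDerivAt c y).continuousAt

lemma psi_strictMono (c : ℝ) : StrictMono (psi c) := by
  apply strictMono_of_deriv_pos
  intro y
  rw [psi_deriv]
  have := Real.sqrt_pos.2 (psi_arg_pos c y)
  positivity

lemma psi_lipschitz (c : ℝ) : LipschitzWith 1 (psi c) := by
  apply lipschitzWith_of_nnnorm_deriv_le (fun y => (psi_hasDerivAt c y).differentiableAt)
  intro y
  rw [← NNReal.coe_le_coe, coe_nnnorm, psi_deriv]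
  have h : 1 ≤ Real.sqrt (1 + y ^ 2 / c ^ 2) := by
    rw [Real.one_le_sqrt]; have : 0 ≤ y ^ 2 / c ^ 2 := by positivity
    linarith
  rw [Real.norm_of_nonneg (by positivity)]
  simp only [NNReal.coe_one]
  rw [div_le_one (by positivity)]
  exact one_le_pow₀ h

lemma psi_lip (c u v : ℝ) : |psi c u - psi c v| ≤ |u - v| := by
  have := (psi_lipschitz c).dist_le_mul u v
  simpa [Real.dist_eq] using this

lemma abs_psi_lt {c : ℝ} (hc : 0 < c) (y : ℝ) : |psi c y| < c := by
  have h0 := psi_arg_pos c y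
  have hp := Real.sqrt_pos.2 h0
  rw [psi, abs_div, abs_of_pos hp, div_lt_iff₀ hp]
  have h1 : |y| / c < Real.sqrt (1 + y ^ 2 / c ^ 2) := by
    apply Real.lt_sqrt_of_sq_lt
    rw [div_pow, sq_abs]; linarith
  rw [div_lt_iff₀ hc] at h1
  linarith

lemma psi_phi {c : ℝ} (hc : 0 < c) {v : ℝ} (hv : |v| < c) : psi c (phi c v) = v := by
  have h2 : v ^ 2 < c ^ 2 := by
    rw [← sq_abs v]; exact pow_lt_pow_left₀ hv (abs_nonneg _) (by norm_num)
  have h1 : 0 < 1 - v ^ 2 / c ^ 2 := by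
    rw [sub_pos, div_lt_one (by positivity)]; exact h2
  have hp := Real.sqrt_pos.2 h1
  have hs := Real.sq_sqrt h1.le
  unfold psi phi
  have h3 : 1 + (v / Real.sqrt (1 - v ^ 2 / c ^ 2)) ^ 2 / c ^ 2
      = (1 / Real.sqrt (1 - v ^ 2 / c ^ 2)) ^ 2 := by
    rw [div_pow, div_pow, hs]
    have hcv : c ^ 2 - v ^ 2 ≠ 0 := by linarith
    field_simp
    ring
  rw [h3, Real.sqrt_sq (by positivity)]
  generalize Real.sqrt (1 - v ^ 2 / c ^ 2) = r at hp
  field_simp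

lemma phi_psi {c : ℝ} (hc : 0 < c) (y : ℝ) : phi c (psi c y) = y := by
  have h0 := psi_arg_pos c y
  have hp := Real.sqrt_pos.2 h0
  have hs := Real.sq_sqrt h0.le
  unfold psi phi
  have h3 : 1 - (y / Real.sqrt (1 + y ^ 2 / c ^ 2)) ^ 2 / c ^ 2
      = (1 / Real.sqrt (1 + y ^ 2 / c ^ 2)) ^ 2 := by
    rw [div_pow, div_pow, hs]
    field_simp
    ring
  rw [h3, Real.sqrt_sq (by positivity)]
  field_simp

/-- First order system form. -/
def Sys (c a : ℝ) (f x y : ℝ → ℝ) : Prop :=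
  ∀ t, HasDerivAt x (psi c (y t)) t ∧ HasDerivAt y (f t - a * psi c (y t)) t

lemma Sys.contx {c a : ℝ} {f x y : ℝ → ℝ} (h : Sys c a f x y) : Continuous x :=
  continuous_iff_continuousAt.2 fun t => (h t).1.continuousAt

lemma Sys.conty {c a : ℝ} {f x y : ℝ → ℝ} (h : Sys c a f x y) : Continuous y :=
  continuous_iff_continuousAt.2 fun t => (h t).2.continuousAt

lemma sys_of_isPendSol {c a b T : ℝ} (hc : 0 < c) {p x : ℝ → ℝ} (h : IsPendSol c a b T p x) :
    ∃ y, Function.Periodic x T ∧ Function.Periodic y T ∧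
      Sys c a (fun t => p t - b * Real.sin (x t)) x y := by
  obtain ⟨hper, hx, hlt, hy, heq⟩ := h
  have hdp : Function.Periodic (deriv x) T := by
    intro t
    have : deriv (fun s => x (s + T)) t = deriv x (t + T) := deriv_comp_add_const x T t
    rw [← this]; congr 1; funext s; exact hper s
  refine ⟨fun t => phi c (deriv x t), hper, fun t => by simp only [hdp t], fun t => ⟨?_, ?_⟩⟩
  · rw [psi_phi hc (hlt t)]
    exact (hx.differentiable (by norm_num) t).hasDerivAt
  · have := (hy.differentiable (by norm_num) t).hasDerivAt
    refine this.congr_deriv ?_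
    rw [psi_phi hc (hlt t)]
    linarith [heq t]

lemma isPendSol_of_sys {c a b T : ℝ} (hc : 0 < c) {p x y : ℝ → ℝ} (hp : Continuous p)
    (hx : Function.Periodic x T)
    (h : Sys c a (fun t => p t - b * Real.sin (x t)) x y) : IsPendSol c a b T p x := by
  have hd : deriv x = fun t => psi c (y t) := funext fun t => (h t).1.deriv
  have hph : (fun t => phi c (deriv x t)) = y := by
    funext t; rw [hd]; exact phi_psi hc _
  have hdy : deriv y = fun t => p t - b * Real.sin (x t) - a * psi c (y t) :=
    funext fun t => (h t).2.deriv
  have cx := h.contx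
  have cy := h.conty
  have cp := psi_continuous c
  refine ⟨hx, ?_, ?_, ?_, ?_⟩
  · rw [contDiff_one_iff_deriv]
    refine ⟨fun t => (h t).1.differentiableAt, ?_⟩
    rw [hd]; fun_prop
  · intro t; rw [hd]; exact abs_psi_lt hc _
  · rw [hph, contDiff_one_iff_deriv]
    refine ⟨fun t => (h t).2.differentiableAt, ?_⟩
    rw [hdy]; fun_prop
  · intro t
    rw [hph, hdy, hd]; ring

lemma periodic_exists_max {T : ℝ} (hT : 0 < T) {u : ℝ → ℝ} (hu : Continuous u)
    (hp : Function.Periodic u T) : ∃ t₀, ∀ t, u t ≤ u t₀ := by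
  obtain ⟨t₀, -, h⟩ := isCompact_Icc.exists_isMaxOn (nonempty_Icc.2 hT.le) hu.continuousOn
  refine ⟨t₀, fun t => ?_⟩
  obtain ⟨s, hs, hst⟩ := hp.exists_mem_Ico₀ hT t
  rw [hst]
  exact h ⟨hs.1, hs.2.le⟩

lemma periodic_bdd {T : ℝ} (hT : 0 < T) {u : ℝ → ℝ} (hu : Continuous u)
    (hp : Function.Periodic u T) : ∃ K, 0 < K ∧ ∀ t, |u t| ≤ K := by
  obtain ⟨t₀, h⟩ := periodic_exists_max (u := fun t => |u t|) hT hu.abs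
    (fun t => by simp only [hp t])
  exact ⟨|u t₀| + 1, by positivity, fun t => by linarith [h t]⟩

/-- local increase after a critical point. -/
lemma local_increase {c : ℝ} {x₁ y₁ x₂ y₂ : ℝ → ℝ} {d t₀ t₁ : ℝ} (ht : t₀ < t₁)
    (hx : ∀ t ∈ Icc t₀ t₁, HasDerivAt (fun t => x₁ t - x₂ t) (psi c (y₁ t) - psi c (y₂ t)) t)
    (hy : HasDerivAt (fun t => y₁ t - y₂ t) d t₀) (h0 : y₁ t₀ = y₂ t₀) (hd : 0 < d) :
    ∃ s ∈ Ioc t₀ t₁, x₁ t₀ - x₂ t₀ < x₁ s - x₂ s := by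
  have h1 : ∀ᶠ s in nhdsWithin t₀ (Ioi t₀), 0 < slope (fun t => y₁ t - y₂ t) t₀ s := by
    have h2 := (hasDerivAt_iff_tendsto_slope.1 hy).mono_left
      (nhdsWithin_mono t₀ (fun s (hs : s ∈ Ioi t₀) => (ne_of_gt hs : s ≠ t₀)))
    exact h2.eventually (lt_mem_nhds hd)
  obtain ⟨u, hu, hsub⟩ := mem_nhdsGT_iff_exists_Ioc_subset.1 h1
  have hu' : t₀ < u := hu
  set w := min u t₁ with hw
  have hw0 : t₀ < w := lt_min hu' ht
  refine ⟨w, ⟨hw0, min_le_right _ _⟩, ?_⟩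
  have hmem : ∀ s ∈ Icc t₀ w, s ∈ Icc t₀ t₁ := fun s hs => ⟨hs.1, hs.2.trans (min_le_right _ _)⟩
  have hmono : StrictMonoOn (fun t => x₁ t - x₂ t) (Icc t₀ w) := by
    apply strictMonoOn_of_deriv_pos (convex_Icc _ _)
    · exact fun s hs => (hx s (hmem s hs)).continuousAt.continuousWithinAt
    · intro s hs
      rw [interior_Icc] at hs
      rw [(hx s (hmem s ⟨hs.1.le, hs.2.le⟩)).deriv, sub_pos]
      apply psi_strictMono
      have h3 : 0 < slope (fun t => y₁ t - y₂ t) t₀ s :=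
        hsub ⟨hs.1, hs.2.le.trans (min_le_left _ _)⟩
      rw [slope_def_field, h0, sub_self, sub_zero] at h3
      have := (div_pos_iff_of_pos_right (sub_pos.2 hs.1)).1 h3
      linarith
  exact hmono ⟨le_rfl, hw0.le⟩ ⟨hw0.le, le_rfl⟩ hw0

lemma comparison {c a T : ℝ} (hT : 0 < T) {f₁ x₁ y₁ f₂ x₂ y₂ : ℝ → ℝ}
    (h₁ : Sys c a f₁ x₁ y₁) (h₂ : Sys c a f₂ x₂ y₂)
    (p₁ : Function.Periodic x₁ T) (p₂ : Function.Periodic x₂ T)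
    (hf : ∀ t, x₂ t < x₁ t → f₂ t < f₁ t) : ∀ t, x₁ t ≤ x₂ t := by
  obtain ⟨t₀, hmax⟩ := periodic_exists_max (u := fun t => x₁ t - x₂ t) hT
    (h₁.contx.sub h₂.contx) (fun t => by simp only [p₁ t, p₂ t])
  by_contra! hcon
  obtain ⟨t, ht⟩ := hcon
  have hpos : x₂ t₀ < x₁ t₀ := by have := hmax t; linarith
  have hx : ∀ t, HasDerivAt (fun t => x₁ t - x₂ t) (psi c (y₁ t) - psi c (y₂ t)) t :=
    fun t => (h₁ t).1.sub (h₂ t).1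
  have hloc : IsLocalMax (fun t => x₁ t - x₂ t) t₀ := Filter.Eventually.of_forall hmax
  have h0 := hloc.hasDerivAt_eq_zero (hx t₀)
  have hy0 : y₁ t₀ = y₂ t₀ := (psi_strictMono c).injective (by linarith)
  have hy := (h₁ t₀).2.sub (h₂ t₀).2
  obtain ⟨s, -, hs⟩ := local_increase (c := c) (lt_add_one t₀) (fun t _ => hx t) hy hy0
    (by rw [hy0]; linarith [hf t₀ hpos])
  have := hmax s
  linarith

lemma Sys.lip {c a : ℝ} (hc : 0 < c) {f x y : ℝ → ℝ} (h : Sys c a f x y) (s t : ℝ) :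
    |x t - x s| ≤ c * |t - s| := by
  have := convex_univ.norm_image_sub_le_of_norm_hasDerivWithin_le (f := x)
    (f' := fun t => psi c (y t)) (C := c) (fun t _ => (h t).1.hasDerivWithinAt)
    (fun t _ => (abs_psi_lt hc _).le) (mem_univ s) (mem_univ t)
  simpa using this

lemma Sys.y_bound {c a T K : ℝ} (hc : 0 < c) (ha : 0 < a) (hT : 0 < T) {f x y : ℝ → ℝ}
    (h : Sys c a f x y)
    (px : Function.Periodic x T) (py : Function.Periodic y T) (hK : ∀ t, |f t| ≤ K) :
    ∀ t, |y t| ≤ (K + a * c) * T := by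
  have hl : ∀ s t, |y t - y s| ≤ (K + a * c) * |t - s| := by
    intro s t
    have := convex_univ.norm_image_sub_le_of_norm_hasDerivWithin_le (f := y)
      (f' := fun t => f t - a * psi c (y t)) (C := K + a * c)
      (fun t _ => (h t).2.hasDerivWithinAt)
      (fun t _ => by
        rw [Real.norm_eq_abs]
        have h1 := (abs_psi_lt hc (y t)).le
        have h2 := abs_sub (f t) (a * psi c (y t))
        rw [abs_mul, abs_of_pos ha] at h2
        have := mul_le_mul_of_nonneg_left h1 ha.le
        linarith [hK t]) (mem_univ s) (mem_univ t)
    simpa using this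
  obtain ⟨t₀, ht₀, hz⟩ := exists_hasDerivAt_eq_zero (f := x) (f' := fun t => psi c (y t)) hT
    h.contx.continuousOn (by have := px 0; rw [zero_add] at this; exact this.symm)
    (fun t _ => (h t).1)
  have hy0 : y t₀ = 0 := (psi_strictMono c).injective (by rw [hz, psi_zero])
  intro t
  obtain ⟨s, hs, hst⟩ := py.exists_mem_Ico₀ hT t
  have hK0 : 0 ≤ K := (abs_nonneg _).trans (hK 0)
  have := hl t₀ s
  rw [hy0, sub_zero] at this
  rw [hst]
  refine this.trans (mul_le_mul_of_nonneg_left ?_ (by positivity))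
  rw [abs_le]; constructor <;> linarith [hs.1, hs.2, ht₀.1, ht₀.2]

lemma sys_limit {c a T K : ℝ} (hc : 0 < c) (ha : 0 < a) (hT : 0 < T) {f x y : ℕ → ℝ → ℝ}
    {F X : ℝ → ℝ} (h : ∀ n, Sys c a (f n) (x n) (y n))
    (px : ∀ n, Function.Periodic (x n) T) (py : ∀ n, Function.Periodic (y n) T)
    (cf : ∀ n, Continuous (f n)) (hK : ∀ n t, |f n t| ≤ K)
    (hx : ∀ t, Filter.Tendsto (fun n => x n t) Filter.atTop (nhds (X t)))
    (hf : ∀ t, Filter.Tendsto (fun n => f n t) Filter.atTop (nhds (F t)))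
    (hF : Continuous X → Continuous F) :
    ∃ Y, Function.Periodic X T ∧ Function.Periodic Y T ∧ Sys c a F X Y := by
  have cX : Continuous X := by
    have : LipschitzWith c.toNNReal X := by
      apply LipschitzWith.of_dist_le_mul
      intro t s
      rw [Real.coe_toNNReal c hc.le, Real.dist_eq, Real.dist_eq]
      exact le_of_tendsto ((hx t).sub (hx s)).abs
        (Filter.Eventually.of_forall fun n => (h n).lip hc s t)
    exact this.continuous
  have cF := hF cX
  have hyb : ∀ n t, |y n t| ≤ (K + a * c) * T := fun n =>
    (h n).y_bound hc ha hT (px n) (py n) (hK n)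
  obtain ⟨η, -, φ, hφ, hη⟩ := (isCompact_Icc (a := -((K + a * c) * T))
    (b := (K + a * c) * T)).tendsto_subseq (fun n => abs_le.1 (hyb n 0))
  have hφt := hφ.tendsto_atTop
  have cp := psi_continuous c
  -- integral formulas
  have Iy : ∀ n t, y n t = y n 0 + (∫ s in (0:ℝ)..t, f n s) - a * (x n t - x n 0) := by
    intro n t
    have := intervalIntegral.integral_eq_sub_of_hasDerivAt (a := 0) (b := t)
      (f := fun s => y n s + a * x n s) (f' := f n)
      (fun s _ => by
        refine ((h n s).2.add ((h n s).1.const_mul a)).congr_deriv ?_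
        ring) ((cf n).intervalIntegrable _ _)
    rw [this]; ring
  have Ix : ∀ n t, x n t = x n 0 + ∫ s in (0:ℝ)..t, psi c (y n s) := by
    intro n t
    have cy := (h n).conty
    have := intervalIntegral.integral_eq_sub_of_hasDerivAt (a := 0) (b := t)
      (f := x n) (f' := fun s => psi c (y n s))
      (fun s _ => (h n s).1) ((cp.comp cy).intervalIntegrable _ _)
    rw [this]; ring
  set Y : ℝ → ℝ := fun t => η + (∫ s in (0:ℝ)..t, F s) - a * (X t - X 0) with hY
  have hYt : ∀ t, Filter.Tendsto (fun n => y (φ n) t) Filter.atTop (nhds (Y t)) := by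
    intro t
    have h1 : Filter.Tendsto (fun n => ∫ s in (0:ℝ)..t, f (φ n) s) Filter.atTop
        (nhds (∫ s in (0:ℝ)..t, F s)) := by
      apply intervalIntegral.tendsto_integral_filter_of_dominated_convergence (fun _ => K)
      · exact Filter.Eventually.of_forall fun n => (cf _).aestronglyMeasurable
      · exact Filter.Eventually.of_forall fun n => Filter.Eventually.of_forall fun s _ => hK _ s
      · exact intervalIntegrable_const
      · exact Filter.Eventually.of_forall fun s _ => (hf s).comp hφt
    have h2 := ((hη.add h1).sub ((((hx t).comp hφt).sub ((hx 0).comp hφt)).const_mul a))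
    refine h2.congr fun n => ?_
    rw [Iy (φ n) t]; rfl
  have hXt : ∀ t, X t = X 0 + ∫ s in (0:ℝ)..t, psi c (Y s) := by
    intro t
    have h1 : Filter.Tendsto (fun n => ∫ s in (0:ℝ)..t, psi c (y (φ n) s)) Filter.atTop
        (nhds (∫ s in (0:ℝ)..t, psi c (Y s))) := by
      apply intervalIntegral.tendsto_integral_filter_of_dominated_convergence (fun _ => c)
      · exact Filter.Eventually.of_forall fun n =>
          (cp.comp (h _).conty).aestronglyMeasurable
      · exact Filter.Eventually.of_forall fun n => Filter.Eventually.of_forall fun s _ =>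
          (abs_psi_lt hc _).le
      · exact intervalIntegrable_const
      · exact Filter.Eventually.of_forall fun s _ => (cp.tendsto _).comp (hYt s)
    refine tendsto_nhds_unique ((hx t).comp hφt) ((((hx 0).comp hφt).add h1).congr fun n => ?_)
    exact (Ix (φ n) t).symm
  have cI : Continuous (fun t => ∫ s in (0:ℝ)..t, F s) :=
    intervalIntegral.continuous_primitive (fun _ _ => cF.intervalIntegrable _ _) 0
  have cY : Continuous Y := by rw [hY]; fun_prop
  have dX : ∀ t, HasDerivAt X (psi c (Y t)) t := by
    intro t
    have := ((cp.comp cY).integral_hasStrictDerivAt 0 t).hasDerivAt.const_add (X 0)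
    exact this.congr_of_eventuallyEq (Filter.Eventually.of_forall hXt)
  refine ⟨Y, fun t => ?_, fun t => ?_, fun t => ⟨dX t, ?_⟩⟩
  · refine tendsto_nhds_unique (hx (t + T)) ((hx t).congr fun n => (px n t).symm)
  · refine tendsto_nhds_unique (hYt (t + T)) ((hYt t).congr fun n => (py _ t).symm)
  · have h1 := (cF.integral_hasStrictDerivAt 0 t).hasDerivAt.const_add η
    exact h1.sub (((dX t).sub_const (X 0)).const_mul a)

/-- pointwise extraction for equi-Lipschitz bounded sequences -/
lemma extract {c R : ℝ} (hc : 0 < c) {x : ℕ → ℝ → ℝ} (hl : ∀ n s t, |x n t - x n s| ≤ c * |t - s|)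
    (hR : ∀ n t, |x n t| ≤ R) :
    ∃ (φ : ℕ → ℕ) (X : ℝ → ℝ), StrictMono φ ∧
      ∀ t, Filter.Tendsto (fun n => x (φ n) t) Filter.atTop (nhds (X t)) := by
  obtain ⟨Z, -, φ, hφ, hZ⟩ := (isCompact_univ_pi (ι := ℚ) (X := fun _ => ℝ)
    (s := fun _ => Icc (-R) R) (fun _ => isCompact_Icc)).tendsto_subseq
    (x := fun n (q : ℚ) => x n q) (fun n => fun q _ => abs_le.1 (hR n q))
  have hZ' : ∀ q : ℚ, Filter.Tendsto (fun n => x (φ n) q) Filter.atTop (nhds (Z q)) :=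
    fun q => (tendsto_pi_nhds.1 hZ) q
  have hC : ∀ t, CauchySeq (fun n => x (φ n) t) := by
    intro t
    rw [Metric.cauchySeq_iff']
    intro ε hε
    obtain ⟨q, hq1, hq2⟩ := exists_rat_btwn (show t < t + ε / (4 * c) by
      have : 0 < ε / (4 * c) := by positivity
      linarith)
    obtain ⟨N, hN⟩ := Metric.cauchySeq_iff'.1 (hZ' q).cauchySeq (ε / 4) (by positivity)
    refine ⟨N, fun n hn => ?_⟩
    have hb : ∀ m, |x m t - x m q| ≤ ε / 4 := by
      intro m
      refine (hl m q t).trans ?_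
      have : |t - q| ≤ ε / (4 * c) := by rw [abs_le]; constructor <;> linarith
      calc c * |t - q| ≤ c * (ε / (4 * c)) := mul_le_mul_of_nonneg_left this hc.le
        _ = ε / 4 := by field_simp
    have h1 := hN n hn
    rw [Real.dist_eq] at h1 ⊢
    have h2 := abs_le.1 (hb (φ n))
    have h3 := abs_le.1 (hb (φ N))
    have h4 := abs_lt.1 h1
    rw [abs_lt]; constructor <;> linarith [h2.1, h2.2, h3.1, h3.2, h4.1, h4.2]
  choose X hX using fun t => cauchySeq_tendsto_of_complete (hC t)
  exact ⟨φ, X, hφ, hX⟩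

lemma ivp_exists {E : Type*} [NormedAddCommGroup E] [NormedSpace ℝ E] [CompleteSpace E]
    {v : ℝ → E → E} {K L : NNReal} (hv : ∀ t, LipschitzWith K (v t))
    (hc : ∀ z, Continuous (fun t => v t z)) (hL : ∀ t z, ‖v t z‖ ≤ L) {T : ℝ} (hT : 0 < T)
    (z₀ : E) : ∃ z : ℝ → E, z 0 = z₀ ∧ ∀ t ∈ Icc 0 T, HasDerivAt z (v t (z t)) t := by
  have h0 : (0:ℝ) ∈ Icc (-1) (T + 1) := ⟨by norm_num, by linarith⟩
  have hPL : IsPicardLindelof v (⟨0, h0⟩ : Icc (-1:ℝ) (T + 1)) z₀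
      (L * (T + 1).toNNReal) 0 L K := by
    refine ⟨fun t _ => (hv t).lipschitzOnWith, fun z _ => (hc z).continuousOn,
      fun t _ z _ => hL t z, ?_⟩
    simp only [NNReal.coe_mul, NNReal.coe_zero, sub_zero]
    rw [Real.coe_toNNReal _ (by linarith)]
    refine mul_le_mul_of_nonneg_left ?_ L.2
    exact max_le (by simp) (by linarith)
  obtain ⟨z, hz0, hz⟩ := hPL.exists_eq_forall_mem_Icc_hasDerivWithinAt₀
  refine ⟨z, hz0, fun t ht => ?_⟩
  refine (hz t ⟨by linarith [ht.1], by linarith [ht.2]⟩).hasDerivAt ?_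
  exact Icc_mem_nhds (by linarith [ht.1]) (by linarith [ht.2])

lemma ivp_dist {E : Type*} [NormedAddCommGroup E] [NormedSpace ℝ E]
    {v : ℝ → E → E} {K : NNReal} (hv : ∀ t, LipschitzWith K (v t)) {T : ℝ} (hT : 0 < T)
    {z w : ℝ → E} (hz : ∀ t ∈ Icc 0 T, HasDerivAt z (v t (z t)) t)
    (hw : ∀ t ∈ Icc 0 T, HasDerivAt w (v t (w t)) t) :
    dist (z T) (w T) ≤ dist (z 0) (w 0) * Real.exp (K * T) := by
  have := dist_le_of_trajectories_ODE (a := 0) (b := T) (f := z) (g := w) hv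
    (fun t ht => (hz t ht).continuousAt.continuousWithinAt)
    (fun t ht => (hz t ⟨ht.1, ht.2.le⟩).hasDerivWithinAt)
    (fun t ht => (hw t ht).continuousAt.continuousWithinAt)
    (fun t ht => (hw t ⟨ht.1, ht.2.le⟩).hasDerivWithinAt) le_rfl T ⟨hT.le, le_rfl⟩
  simpa using this

/-- local-in-[0,T] system with nonlinearity g -/
def SysOn (c a T : ℝ) (g : ℝ → ℝ → ℝ) (x y : ℝ → ℝ) : Prop :=
  ∀ t ∈ Icc 0 T, HasDerivAt x (psi c (y t)) t ∧
    HasDerivAt y (g t (x t) - a * psi c (y t)) t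

lemma sysOn_order {c a T : ℝ} (ha : 0 < a) (hT : 0 < T) {g : ℝ → ℝ → ℝ}
    (hg : ∀ t, Monotone (g t)) {x₁ y₁ x₂ y₂ : ℝ → ℝ}
    (h₁ : SysOn c a T g x₁ y₁) (h₂ : SysOn c a T g x₂ y₂)
    (hx0 : x₁ 0 = x₂ 0) (hy0 : y₁ 0 < y₂ 0) : x₁ T < x₂ T := by
  -- claim: y₁ < y₂ on [0,T]
  have key : ∀ t ∈ Icc 0 T, (∀ s ∈ Ico 0 t, y₁ s < y₂ s) → MonotoneOn (fun s => x₂ s - x₁ s) (Icc 0 t) := by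
    intro t ht hs
    apply monotoneOn_of_deriv_nonneg (convex_Icc _ _)
    · exact fun s hs => ((h₂ s ⟨hs.1, hs.2.trans ht.2⟩).1.sub
        (h₁ s ⟨hs.1, hs.2.trans ht.2⟩).1).continuousAt.continuousWithinAt
    · intro s hs
      rw [interior_Icc] at hs
      exact ((h₂ s ⟨hs.1.le, hs.2.le.trans ht.2⟩).1.sub
        (h₁ s ⟨hs.1.le, hs.2.le.trans ht.2⟩).1).differentiableAt.differentiableWithinAt
    · intro s hs'
      rw [interior_Icc] at hs'
      rw [((h₂ s ⟨hs'.1.le, hs'.2.le.trans ht.2⟩).1.fun_sub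
        (h₁ s ⟨hs'.1.le, hs'.2.le.trans ht.2⟩).1).deriv]
      have := psi_strictMono c (hs s ⟨hs'.1.le, hs'.2⟩)
      linarith
  have key2 : ∀ t ∈ Icc 0 T, (∀ s ∈ Ico 0 t, y₁ s < y₂ s) → y₁ t < y₂ t := by
    intro t ht hs
    have hm := key t ht hs
    have hxs : ∀ s ∈ Icc 0 t, x₁ s ≤ x₂ s := by
      intro s hs
      have := hm ⟨le_rfl, ht.1⟩ hs hs.1
      simp only [hx0, sub_self] at this
      linarith
    have hder : ∀ s ∈ Icc 0 T, HasDerivAt (fun s => Real.exp (a * s) * (y₂ s - y₁ s))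
        (Real.exp (a * s) * a * (y₂ s - y₁ s) + Real.exp (a * s) *
          ((g s (x₂ s) - a * psi c (y₂ s)) - (g s (x₁ s) - a * psi c (y₁ s)))) s := by
      intro s hs
      have he : HasDerivAt (fun s => Real.exp (a * s)) (Real.exp (a * s) * a) s := by
        have := ((hasDerivAt_id s).const_mul a).exp
        simpa using this
      exact he.mul ((h₂ s hs).2.sub (h₁ s hs).2)
    have hm2 : MonotoneOn (fun s => Real.exp (a * s) * (y₂ s - y₁ s)) (Icc 0 t) := by
      apply monotoneOn_of_deriv_nonneg (convex_Icc _ _)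
      · exact fun s hs => (hder s ⟨hs.1, hs.2.trans ht.2⟩).continuousAt.continuousWithinAt
      · intro s hs
        rw [interior_Icc] at hs
        exact (hder s ⟨hs.1.le, hs.2.le.trans ht.2⟩).differentiableAt.differentiableWithinAt
      · intro s hs'
        rw [interior_Icc] at hs'
        rw [(hder s ⟨hs'.1.le, hs'.2.le.trans ht.2⟩).deriv]
        have hyy := hs s ⟨hs'.1.le, hs'.2⟩
        have h1 := psi_lip c (y₂ s) (y₁ s)
        rw [abs_of_pos (sub_pos.2 hyy)] at h1
        have h2 := (le_abs_self _).trans h1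
        have h3 := hg s (hxs s ⟨hs'.1.le, hs'.2.le⟩)
        have h4 := mul_le_mul_of_nonneg_left h2 ha.le
        have : 0 ≤ Real.exp (a * s) * (a * (y₂ s - y₁ s) +
          ((g s (x₂ s) - a * psi c (y₂ s)) - (g s (x₁ s) - a * psi c (y₁ s)))) := by
          apply mul_nonneg (Real.exp_pos _).le
          linarith
        linarith
    have := hm2 ⟨le_rfl, ht.1⟩ ⟨ht.1, le_rfl⟩ ht.1
    simp only [mul_zero, Real.exp_zero, one_mul] at this
    have h5 : 0 < Real.exp (a * t) * (y₂ t - y₁ t) := by linarith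
    have := (mul_pos_iff_of_pos_left (Real.exp_pos _)).1 h5
    linarith
  have key3 : ∀ t ∈ Icc 0 T, y₁ t < y₂ t := by
    by_contra! hcon
    obtain ⟨t, ht, hle⟩ := hcon
    have cy : ContinuousOn (fun s => y₂ s - y₁ s) (Icc 0 t) := fun s hs =>
      ((h₂ s ⟨hs.1, hs.2.trans ht.2⟩).2.sub
        (h₁ s ⟨hs.1, hs.2.trans ht.2⟩).2).continuousAt.continuousWithinAt
    -- first bad time
    set S := {s ∈ Icc 0 t | y₂ s - y₁ s ≤ 0} with hS
    have hSc : IsClosed S := by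
      have := cy.preimage_isClosed_of_isClosed isClosed_Icc (isClosed_Iic (a := (0:ℝ)))
      exact this
    have hSne : S.Nonempty := ⟨t, ⟨ht.1, le_rfl⟩, by linarith⟩
    have hSb : BddBelow S := ⟨0, fun s hs => hs.1.1⟩
    have hmem := hSc.csInf_mem hSne hSb
    have := key2 (sInf S) ⟨hmem.1.1, hmem.1.2.trans ht.2⟩ (fun s hs => by
      by_contra! hcon
      have : s ∈ S := ⟨⟨hs.1, hs.2.le.trans hmem.1.2⟩, by linarith⟩
      exact absurd (csInf_le hSb this) (not_le.2 hs.2))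
    linarith [hmem.2]
  have hsm : StrictMonoOn (fun s => x₂ s - x₁ s) (Icc 0 T) := by
    apply strictMonoOn_of_deriv_pos (convex_Icc _ _)
    · exact fun s hs => ((h₂ s hs).1.sub (h₁ s hs).1).continuousAt.continuousWithinAt
    · intro s hs
      rw [interior_Icc] at hs
      have hs' : s ∈ Icc 0 T := ⟨hs.1.le, hs.2.le⟩
      rw [((h₂ s hs').1.fun_sub (h₁ s hs').1).deriv]
      have := psi_strictMono c (key3 s hs')
      linarith
  have := hsm ⟨le_rfl, hT.le⟩ ⟨hT.le, le_rfl⟩ hT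
  simp only [hx0, sub_self] at this
  linarith

lemma sysOn_y_lip {c a T B : ℝ} (hc : 0 < c) (ha : 0 < a) {g : ℝ → ℝ → ℝ}
    (hB : ∀ t x, |g t x| ≤ B) {x y : ℝ → ℝ} (h : SysOn c a T g x y) (hT : 0 < T) :
    ∀ t ∈ Icc 0 T, |y t - y 0| ≤ (B + a * c) * T := by
  intro t ht
  have hB0 : 0 ≤ B := (abs_nonneg _).trans (hB 0 0)
  have := (convex_Icc 0 T).norm_image_sub_le_of_norm_hasDerivWithin_le (f := y)
    (f' := fun t => g t (x t) - a * psi c (y t)) (C := B + a * c)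
    (fun t ht => (h t ht).2.hasDerivWithinAt)
    (fun t _ => by
      rw [Real.norm_eq_abs]
      have h1 := (abs_psi_lt hc (y t)).le
      have h2 := abs_sub (g t (x t)) (a * psi c (y t))
      rw [abs_mul, abs_of_pos ha] at h2
      have := mul_le_mul_of_nonneg_left h1 ha.le
      linarith [hB t (x t)]) (⟨le_rfl, hT.le⟩ : (0:ℝ) ∈ Icc 0 T) ht
  simp only [Real.norm_eq_abs, sub_zero] at this
  refine this.trans (mul_le_mul_of_nonneg_left ?_ (by positivity))
  rw [abs_of_nonneg ht.1]; exact ht.2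

lemma sysOn_x_mono {c a T : ℝ} {g : ℝ → ℝ → ℝ} {x y : ℝ → ℝ} (h : SysOn c a T g x y)
    (hT : 0 < T) (hy : ∀ t ∈ Icc 0 T, 0 ≤ y t) : x 0 ≤ x T := by
  have : MonotoneOn x (Icc 0 T) := by
    apply monotoneOn_of_deriv_nonneg (convex_Icc _ _)
    · exact fun s hs => (h s hs).1.continuousAt.continuousWithinAt
    · intro s hs
      exact (h s (interior_subset hs)).1.differentiableAt.differentiableWithinAt
    · intro s hs
      rw [(h s (interior_subset hs)).1.deriv, ← psi_zero c]
      exact (psi_strictMono c).monotone (hy s (interior_subset hs))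
  exact this ⟨le_rfl, hT.le⟩ ⟨hT.le, le_rfl⟩ hT.le

lemma sysOn_x_anti {c a T : ℝ} {g : ℝ → ℝ → ℝ} {x y : ℝ → ℝ} (h : SysOn c a T g x y)
    (hT : 0 < T) (hy : ∀ t ∈ Icc 0 T, y t ≤ 0) : x T ≤ x 0 := by
  have : AntitoneOn x (Icc 0 T) := by
    apply antitoneOn_of_deriv_nonpos (convex_Icc _ _)
    · exact fun s hs => (h s hs).1.continuousAt.continuousWithinAt
    · intro s hs
      exact (h s (interior_subset hs)).1.differentiableAt.differentiableWithinAt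
    · intro s hs
      rw [(h s (interior_subset hs)).1.deriv, ← psi_zero c]
      exact (psi_strictMono c).monotone (hy s (interior_subset hs))
  exact this ⟨le_rfl, hT.le⟩ ⟨hT.le, le_rfl⟩ hT.le

lemma psi_neg (c y : ℝ) : psi c (-y) = -psi c y := by simp [psi, neg_div]

lemma sysOn_top {c a T M : ℝ} (hT : 0 < T) {g : ℝ → ℝ → ℝ}
    (hg : ∀ t x, M ≤ x → 0 < g t x) {x y : ℝ → ℝ}
    (h : SysOn c a T g x y) (h0 : x 0 = M) (h1 : x T = M) : y 0 ≤ 0 ∧ 0 ≤ y T := by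
  have hle : ∀ t ∈ Icc 0 T, x t ≤ M := by
    obtain ⟨t₀, ht₀, hmax⟩ := isCompact_Icc.exists_isMaxOn (nonempty_Icc.2 hT.le)
      (f := x) (fun s hs => (h s hs).1.continuousAt.continuousWithinAt)
    intro t ht
    by_contra! hcon
    have hM : M < x t₀ := hcon.trans_le (hmax ht)
    have h00 : t₀ ≠ 0 := by rintro rfl; linarith
    have h0T : t₀ ≠ T := by rintro rfl; linarith
    have hl : 0 < t₀ := lt_of_le_of_ne ht₀.1 (Ne.symm h00)
    have hr : t₀ < T := lt_of_le_of_ne ht₀.2 h0T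
    have hloc : IsLocalMax x t₀ := hmax.isLocalMax (Icc_mem_nhds hl hr)
    have hz := hloc.hasDerivAt_eq_zero (h t₀ ht₀).1
    have hy0 : y t₀ = 0 := (psi_strictMono c).injective (by rw [hz, psi_zero])
    obtain ⟨s, hs, hs'⟩ := local_increase (c := c) (x₁ := x) (y₁ := y) (x₂ := fun _ => 0)
      (y₂ := fun _ => 0) (d := g t₀ (x t₀) - a * psi c (y t₀)) hr
      (fun t ht => by
        simpa [psi_zero] using (h t ⟨hl.le.trans ht.1, ht.2⟩).1)
      (by simpa using (h t₀ ht₀).2) hy0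
      (by rw [hy0, psi_zero, mul_zero, sub_zero]; exact hg _ _ hM.le)
    have : x s ≤ x t₀ := hmax ⟨hl.le.trans hs.1.le, hs.2⟩
    linarith
  have hm0 : (0:ℝ) ∈ Icc 0 T := ⟨le_rfl, hT.le⟩
  have hmT : T ∈ Icc 0 T := ⟨hT.le, le_rfl⟩
  constructor
  · have h2 := (hasDerivAt_iff_tendsto_slope.1 (h 0 hm0).1).mono_left
      (nhdsWithin_mono (0:ℝ) (fun s (hs : s ∈ Ioi 0) => (ne_of_gt hs : s ≠ 0)))
    have h3 : psi c (y 0) ≤ 0 := by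
      refine le_of_tendsto h2 ?_
      filter_upwards [Ioc_mem_nhdsGT hT] with s hs
      rw [slope_def_field]
      exact div_nonpos_of_nonpos_of_nonneg (by linarith [hle s ⟨hs.1.le, hs.2⟩])
        (by linarith [hs.1])
    exact (psi_strictMono c).le_iff_le.1 (by rw [psi_zero]; exact h3)
  · have h2 := (hasDerivAt_iff_tendsto_slope.1 (h T hmT).1).mono_left
      (nhdsWithin_mono (T:ℝ) (fun s (hs : s ∈ Iio T) => (ne_of_lt hs : s ≠ T)))
    have h3 : 0 ≤ psi c (y T) := by
      refine ge_of_tendsto h2 ?_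
      filter_upwards [Ico_mem_nhdsLT hT] with s hs
      rw [slope_def_field]
      exact div_nonneg_of_nonpos (by linarith [hle s ⟨hs.1, hs.2.le⟩]) (by linarith [hs.2])
    exact (psi_strictMono c).le_iff_le.1 (by rw [psi_zero]; exact h3)

lemma sysOn_bot {c a T M : ℝ} (hT : 0 < T) {g : ℝ → ℝ → ℝ}
    (hg : ∀ t x, x ≤ -M → g t x < 0) {x y : ℝ → ℝ}
    (h : SysOn c a T g x y) (h0 : x 0 = -M) (h1 : x T = -M) : 0 ≤ y 0 ∧ y T ≤ 0 := by
  have := sysOn_top (c := c) (a := a) (M := M) hT (g := fun t x => -g t (-x))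
    (x := fun t => -x t) (y := fun t => -y t)
    (fun t x hx => by have := hg t (-x) (by linarith); linarith)
    (fun t ht => ⟨by
      rw [psi_neg]; exact (h t ht).1.neg, by
      rw [psi_neg]
      exact (h t ht).2.neg.congr_deriv (by simp only [neg_neg]; ring)⟩) (by simp [h0]) (by simp [h1])
  constructor <;> linarith [this.1, this.2]

lemma shoot {c a T M B : ℝ} {Kg : NNReal} (hc : 0 < c) (ha : 0 < a) (hT : 0 < T) (hM : 0 < M)
    {g : ℝ → ℝ → ℝ} (hgm : ∀ t, Monotone (g t)) (hgc : ∀ x, Continuous (fun t => g t x))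
    (hgl : ∀ t, LipschitzWith Kg (g t)) (hgB : ∀ t x, |g t x| ≤ B)
    (hg1 : ∀ t x, M ≤ x → 0 < g t x) (hg2 : ∀ t x, x ≤ -M → g t x < 0) :
    ∃ x y, SysOn c a T g x y ∧ x T = x 0 ∧ y T = y 0 := by
  have hB0 : 0 ≤ B := (abs_nonneg _).trans (hgB 0 0)
  set v : ℝ → ℝ × ℝ → ℝ × ℝ := fun t z => (psi c z.2, g t z.1 - a * psi c z.2) with hv
  have hvl : ∀ t, LipschitzWith (1 + Kg + a.toNNReal) (v t) := by
    intro t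
    apply LipschitzWith.of_dist_le_mul
    intro z w
    have h1 : |z.1 - w.1| ≤ dist z w := by rw [Prod.dist_eq]; exact le_max_left _ _
    have h2 : |z.2 - w.2| ≤ dist z w := by rw [Prod.dist_eq]; exact le_max_right _ _
    have h3 := psi_lip c z.2 w.2
    have h4 := (hgl t).dist_le_mul z.1 w.1
    rw [Real.dist_eq, Real.dist_eq] at h4
    have hd : 0 ≤ dist z w := dist_nonneg
    push_cast
    rw [Real.coe_toNNReal a ha.le]
    rw [Prod.dist_eq]
    have hk : (Kg : ℝ) * |z.1 - w.1| ≤ Kg * dist z w := mul_le_mul_of_nonneg_left h1 Kg.2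
    have hk0 : 0 ≤ (Kg : ℝ) * dist z w := mul_nonneg Kg.2 hd
    have ha0 : 0 ≤ a * dist z w := mul_nonneg ha.le hd
    apply max_le
    · simp only [hv, Real.dist_eq]
      linarith
    · simp only [hv, Real.dist_eq]
      have h5 : g t z.1 - a * psi c z.2 - (g t w.1 - a * psi c w.2)
        = (g t z.1 - g t w.1) - a * (psi c z.2 - psi c w.2) := by ring
      rw [h5]
      have h6 := abs_sub (g t z.1 - g t w.1) (a * (psi c z.2 - psi c w.2))
      rw [abs_mul, abs_of_pos ha] at h6
      have h7 := mul_le_mul_of_nonneg_left (h3.trans h2) ha.le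
      linarith
  have hvc : ∀ z, Continuous (fun t => v t z) := by
    intro z
    have := hgc z.1
    simp only [hv]; fun_prop
  have hvL : ∀ t z, ‖v t z‖ ≤ ((c + B + a * c).toNNReal : ℝ) := by
    intro t z
    rw [Real.coe_toNNReal _ (by positivity), Prod.norm_def]
    have h1 := (abs_psi_lt hc z.2).le
    have hac : 0 ≤ a * c := by positivity
    apply max_le
    · simp only [hv, Real.norm_eq_abs]; linarith
    · simp only [hv, Real.norm_eq_abs]
      have h2 := abs_sub (g t z.1) (a * psi c z.2)
      rw [abs_mul, abs_of_pos ha] at h2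
      have := mul_le_mul_of_nonneg_left h1 ha.le
      linarith [hgB t z.1]
  choose Z hZ0 hZ using fun z₀ => ivp_exists hvl hvc hvL hT z₀
  have hS : ∀ z₀, SysOn c a T g (fun t => (Z z₀ t).1) (fun t => (Z z₀ t).2) := by
    intro z₀ t ht
    have := hZ z₀ t ht
    exact ⟨(ContinuousLinearMap.fst ℝ ℝ ℝ).hasFDerivAt.comp_hasDerivAt t this,
      (ContinuousLinearMap.snd ℝ ℝ ℝ).hasFDerivAt.comp_hasDerivAt t this⟩
  have hPc : Continuous (fun z₀ => Z z₀ T) := by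
    have : LipschitzWith (Real.exp ((1 + Kg + a.toNNReal : NNReal) * T)).toNNReal
        (fun z₀ => Z z₀ T) := by
      apply LipschitzWith.of_dist_le_mul
      intro z w
      have := ivp_dist hvl hT (hZ z) (hZ w)
      rw [hZ0, hZ0] at this
      rw [Real.coe_toNNReal _ (Real.exp_pos _).le]
      linarith
    exact this.continuous
  set D : ℝ → ℝ → ℝ := fun ξ η => (Z (ξ, η) T).1 - ξ with hD
  have hDc1 : ∀ η, Continuous (fun ξ => D ξ η) := by
    intro η
    have : Continuous (fun ξ : ℝ => Z (ξ, η) T) := hPc.comp (by fun_prop)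
    simp only [hD]; fun_prop
  have hDc2 : ∀ ξ, Continuous (fun η => D ξ η) := by
    intro ξ
    have : Continuous (fun η : ℝ => Z (ξ, η) T) := hPc.comp (by fun_prop)
    simp only [hD]; fun_prop
  have hDm : ∀ ξ, StrictMono (D ξ) := by
    intro ξ η₁ η₂ h12
    have := sysOn_order ha hT hgm (hS (ξ, η₁)) (hS (ξ, η₂)) (by simp [hZ0]) (by simpa [hZ0])
    simp only [hD]; linarith
  have hex : ∀ ξ, ∃ η, D ξ η = 0 := by
    intro ξ
    set R := (B + a * c) * T with hR
    have hR0 : 0 ≤ R := by positivity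
    have h1 : 0 ≤ D ξ R := by
      have := sysOn_x_mono (hS (ξ, R)) hT (fun t ht => by
        have := sysOn_y_lip hc ha hgB (hS (ξ, R)) hT t ht
        simp only [hZ0] at this
        have := (abs_le.1 this).1
        linarith)
      simp only [hZ0] at this
      simp only [hD]; linarith
    have h2 : D ξ (-R) ≤ 0 := by
      have := sysOn_x_anti (hS (ξ, -R)) hT (fun t ht => by
        have := sysOn_y_lip hc ha hgB (hS (ξ, -R)) hT t ht
        simp only [hZ0] at this
        have := (abs_le.1 this).2
        linarith)
      simp only [hZ0] at this
      simp only [hD]; linarith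
    obtain ⟨η, -, hη⟩ := intermediate_value_Icc (show -R ≤ R by linarith)
      (hDc2 ξ).continuousOn ⟨h2, h1⟩
    exact ⟨η, hη⟩
  choose e he using hex
  have hec : Continuous e := by
    rw [continuous_iff_continuousAt]
    intro ξ
    rw [ContinuousAt, Metric.tendsto_nhds]
    intro ε hε
    have h1 : 0 < D ξ (e ξ + ε) := by
      rw [← he ξ]; exact hDm ξ (by linarith)
    have h2 : D ξ (e ξ - ε) < 0 := by
      rw [← he ξ]; exact hDm ξ (by linarith)
    filter_upwards [((hDc1 (e ξ + ε)).tendsto ξ).eventually (lt_mem_nhds h1),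
      ((hDc1 (e ξ - ε)).tendsto ξ).eventually (gt_mem_nhds h2)] with ξ' h3 h4
    rw [← he ξ'] at h3 h4
    have h5 := (hDm ξ').lt_iff_lt.1 h3
    have h6 := (hDm ξ').lt_iff_lt.1 h4
    rw [Real.dist_eq, abs_lt]; constructor <;> linarith
  set G : ℝ → ℝ := fun ξ => (Z (ξ, e ξ) T).2 - e ξ with hG
  have hGc : Continuous G := by
    have : Continuous (fun ξ : ℝ => Z (ξ, e ξ) T) := hPc.comp (by fun_prop)
    simp only [hG]; fun_prop
  have hxT : ∀ ξ, (Z (ξ, e ξ) T).1 = ξ := by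
    intro ξ; have := he ξ; simp only [hD] at this; linarith
  have hG1 : 0 ≤ G M := by
    have := sysOn_top hT hg1 (hS (M, e M)) (by simp [hZ0]) (by simp [hxT])
    simp only [hZ0] at this
    simp only [hG]; linarith [this.1, this.2]
  have hG2 : G (-M) ≤ 0 := by
    have := sysOn_bot hT hg2 (hS (-M, e (-M))) (by simp [hZ0]) (by simp [hxT])
    simp only [hZ0] at this
    simp only [hG]; linarith [this.1, this.2]
  obtain ⟨ξ, -, hξ⟩ := intermediate_value_Icc (show -M ≤ M by linarith)
      hGc.continuousOn ⟨hG2, hG1⟩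
  refine ⟨_, _, hS (ξ, e ξ), ?_, ?_⟩
  · simp only [hZ0]; exact hxT ξ
  · simp only [hZ0]; simp only [hG] at hξ; linarith

lemma periodic_deriv_ext {T : ℝ} (hT : 0 < T) {u U W : ℝ → ℝ} (pU : Function.Periodic U T)
    (pW : Function.Periodic W T) (cW : Continuous W) (hu : ∀ t ∈ Icc 0 T, U t = u t)
    (hd : ∀ t ∈ Icc 0 T, HasDerivAt u (W t) t) : ∀ t, HasDerivAt U (W t) t := by
  have hm0 : (0:ℝ) ∈ Icc 0 T := ⟨le_rfl, hT.le⟩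
  have hmT : T ∈ Icc 0 T := ⟨hT.le, le_rfl⟩
  set V : ℝ → ℝ := fun t => u 0 + ∫ s in (0:ℝ)..t, W s with hV
  have h1 : ∀ t ∈ Icc 0 T, V t = U t := by
    intro t ht
    have := intervalIntegral.integral_eq_sub_of_hasDerivAt (a := 0) (b := t) (f := u) (f' := W)
      (fun s hs => hd s (by
        rw [uIcc_of_le ht.1] at hs; exact ⟨hs.1, hs.2.trans ht.2⟩))
      (cW.intervalIntegrable _ _)
    simp only [hV]
    rw [this, hu t ht]; ring
  have hUT : U T = U 0 := by have := pU 0; rwa [zero_add] at this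
  have pV : Function.Periodic V T := by
    intro t
    have h2 := intervalIntegral.integral_add_adjacent_intervals
      (cW.intervalIntegrable (μ := volume) 0 t) (cW.intervalIntegrable t (t + T))
    have h3 := pW.intervalIntegral_add_eq t 0
    have h4 := h1 T hmT
    have h5 := h1 0 hm0
    simp only [hV, intervalIntegral.integral_same, zero_add] at h3 h4 h5 ⊢
    linarith
  have hUV : U = V := by
    funext t
    obtain ⟨k, hk⟩ := pV.exists_mem_Ico₀ hT t
    have e : ∃ n : ℤ, t - n • T ∈ Ico 0 T := by
      obtain ⟨n, hn, -⟩ := existsUnique_sub_zsmul_mem_Ico hT t 0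
      exact ⟨n, by simpa using hn⟩
    obtain ⟨n, hn⟩ := e
    rw [← pU.sub_zsmul_eq n, ← pV.sub_zsmul_eq n]
    exact (h1 _ ⟨hn.1, hn.2.le⟩).symm
  intro t
  rw [hUV]
  exact (cW.integral_hasStrictDerivAt 0 t).hasDerivAt.const_add (u 0)

lemma periodic_cont_ext {T : ℝ} (hT : 0 < T) {u : ℝ → ℝ} (hu : ContinuousOn u (Icc 0 T))
    (h : u T = u 0) : ∃ U : ℝ → ℝ, Continuous U ∧ Function.Periodic U T ∧
      ∀ t ∈ Icc 0 T, U t = u t := by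
  have : Fact (0 < T) := ⟨hT⟩
  have pU : Function.Periodic (fun t : ℝ => AddCircle.liftIco T 0 u (t : AddCircle T)) T := by
    intro t; simp
  refine ⟨fun t => AddCircle.liftIco T 0 u (t : AddCircle T), ?_, pU, ?_⟩
  · exact (AddCircle.liftIco_continuous (by rw [zero_add]; exact h.symm)
      (by rwa [zero_add])).comp (AddCircle.continuous_mk' T)
  · intro t ht
    rcases ht.2.lt_or_eq with hlt | rfl
    · exact AddCircle.liftIco_zero_coe_apply ⟨ht.1, hlt⟩
    · have := pU 0
      rw [zero_add] at this
      simp only at this ⊢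
      rw [this, h]
      exact AddCircle.liftIco_zero_coe_apply ⟨le_rfl, hT⟩

lemma linear_solve {c a T l : ℝ} (hc : 0 < c) (ha : 0 < a) (hT : 0 < T) (hl : 0 < l)
    {h : ℝ → ℝ} (ch : Continuous h) (ph : Function.Periodic h T) :
    ∃ x y, Function.Periodic x T ∧ Function.Periodic y T ∧
      Sys c a (fun t => h t + l * x t) x y := by
  obtain ⟨H, hH0, hH⟩ := periodic_bdd hT ch ph
  set M := (H + 1) / l with hMdef
  have hM : 0 < M := by positivity
  have hlM : l * M = H + 1 := by rw [hMdef]; field_simp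
  set cl : ℝ → ℝ := fun x => max (-M) (min x M) with hcl
  have cl_le : ∀ x, cl x ≤ M := fun x => max_le (by linarith) (min_le_right _ _)
  have le_cl : ∀ x, -M ≤ cl x := fun x => le_max_left _ _
  have clm : Monotone cl := fun x y hxy => max_le_max le_rfl (min_le_min hxy le_rfl)
  have cll : LipschitzWith 1 cl := (LipschitzWith.id.min_const M).const_max (-M)
  have cl1 : ∀ x, M ≤ x → cl x = M := fun x hx => by
    simp only [hcl]; rw [min_eq_right hx, max_eq_right (by linarith)]
  have cl2 : ∀ x, x ≤ -M → cl x = -M := fun x hx => by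
    simp only [hcl]; rw [max_eq_left]; exact (min_le_left _ _).trans hx
  have cl3 : ∀ x, -M ≤ x → x ≤ M → cl x = x := fun x h1 h2 => by
    simp only [hcl]; rw [min_eq_left h2, max_eq_right h1]
  have hg1 : ∀ t x, M ≤ x → 0 < h t + l * cl x := fun t x hx => by
      rw [cl1 x hx, hlM]; linarith [(abs_le.1 (hH t)).1]
  have hg2 : ∀ t x, x ≤ -M → h t + l * cl x < 0 := fun t x hx => by
      rw [cl2 x hx, mul_neg, hlM]; linarith [(abs_le.1 (hH t)).2]
  obtain ⟨x, y, hS, hx, hy⟩ := shoot (c := c) (a := a) (T := T) (M := M) (B := 2 * H + 1)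
    (Kg := l.toNNReal) hc ha hT hM (g := fun t x => h t + l * cl x)
    (fun t u w huw => by
      have := mul_le_mul_of_nonneg_left (clm huw) hl.le
      simp only; linarith)
    (fun x => by fun_prop)
    (fun t => by
      apply LipschitzWith.of_dist_le_mul
      intro u w
      have := cll.dist_le_mul u w
      rw [Real.coe_toNNReal _ hl.le, Real.dist_eq] at *
      simp only [NNReal.coe_one, one_mul] at this
      rw [add_sub_add_left_eq_sub, ← mul_sub, abs_mul, abs_of_pos hl]
      exact mul_le_mul_of_nonneg_left this hl.le)
    (fun t x => by
      have h1 := mul_le_mul_of_nonneg_left (cl_le x) hl.le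
      have h2 := mul_le_mul_of_nonneg_left (le_cl x) hl.le
      have := abs_le.1 (hH t)
      rw [abs_le]; constructor <;> linarith [this.1, this.2]) hg1 hg2
  obtain ⟨X, cX, pX, hX⟩ := periodic_cont_ext hT
    (fun s hs => (hS s hs).1.continuousAt.continuousWithinAt) hx
  obtain ⟨Y, cY, pY, hY⟩ := periodic_cont_ext hT
    (fun s hs => (hS s hs).2.continuousAt.continuousWithinAt) hy
  have cp := psi_continuous c
  have ccl := cll.continuous
  have hSys : Sys c a (fun t => h t + l * cl (X t)) X Y := by
    intro t
    constructor
    · refine periodic_deriv_ext hT pX (W := fun t => psi c (Y t)) (fun t => by simp only [pY t])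
        (by fun_prop) hX (fun t ht => ?_) t
      simp only [hY t ht]; exact (hS t ht).1
    · refine periodic_deriv_ext hT pY (W := fun t => h t + l * cl (X t) - a * psi c (Y t))
        (fun t => by simp only [pY t, pX t, ph t])
        (by fun_prop) hY (fun t ht => ?_) t
      simp only [hY t ht, hX t ht]; exact (hS t ht).2
  have cst : ∀ m : ℝ, Sys c a (fun _ => 0) (fun _ => m) (fun _ => 0) := by
    intro m t
    refine ⟨?_, ?_⟩
    · rw [psi_zero]; exact hasDerivAt_const _ _
    · rw [psi_zero, mul_zero, sub_zero]; exact hasDerivAt_const _ _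
  have b1 : ∀ t, X t ≤ M := comparison hT hSys (cst M) pX (fun _ => rfl)
    (fun t ht => hg1 t _ ht.le)
  have b2 : ∀ t, -M ≤ X t := comparison hT (cst (-M)) hSys (fun _ => rfl) pX
    (fun t ht => hg2 t _ ht.le)
  refine ⟨X, Y, pX, pY, ?_⟩
  have : (fun t => h t + l * X t) = (fun t => h t + l * cl (X t)) := by
    funext t; rw [cl3 _ (b2 t) (b1 t)]
  rw [this]; exact hSys

lemma upper_lower {c a T l : ℝ} (hc : 0 < c) (ha : 0 < a) (hT : 0 < T) (hl : 0 < l)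
    {p k : ℝ → ℝ} (cp : Continuous p) (pp : Function.Periodic p T) (ck : Continuous k)
    (hk : Monotone (fun x => k x + l * x)) {α yα fα β yβ fβ : ℝ → ℝ}
    (hα : Sys c a fα α yα) (pα : Function.Periodic α T) (hfα : ∀ t, p t - k (α t) ≤ fα t)
    (hβ : Sys c a fβ β yβ) (pβ : Function.Periodic β T) (hfβ : ∀ t, fβ t ≤ p t - k (β t))
    (hαβ : ∀ t, α t ≤ β t) :
    ∃ x y, Function.Periodic x T ∧ Function.Periodic y T ∧ (∀ t, α t ≤ x t ∧ x t ≤ β t) ∧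
      Sys c a (fun t => p t - k (x t)) x y := by
  let Low : (ℝ → ℝ) → Prop := fun x => Function.Periodic x T ∧ (∀ t, α t ≤ x t ∧ x t ≤ β t) ∧
    ∃ y f, Sys c a f x y ∧ ∀ t, p t - k (x t) ≤ f t
  have step : ∀ x : {x // Low x}, ∃ x' : {x // Low x}, (∀ t, x.1 t ≤ x'.1 t) ∧
      ∃ y', Function.Periodic y' T ∧
        Sys c a (fun t => (p t - k (x.1 t) - l * x.1 t) + l * x'.1 t) x'.1 y' := by
    rintro ⟨x, px, hx, y, f, hS, hf⟩
    have cx := hS.contx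
    obtain ⟨x', y', px', py', hS'⟩ := linear_solve (h := fun t => p t - k (x t) - l * x t)
      hc ha hT hl (by fun_prop) (fun t => by simp only [pp t, px t])
    have h1 : ∀ t, x t ≤ x' t := comparison hT hS hS' px px' (fun t ht => by
      have := mul_lt_mul_of_pos_left ht hl
      linarith [hf t])
    have h2 : ∀ t, x' t ≤ β t := comparison hT hS' hβ px' pβ (fun t ht => by
      have := mul_lt_mul_of_pos_left ht hl
      have h3 := hk (hx t).2
      simp only at h3
      linarith [hfβ t])
    refine ⟨⟨x', px', fun t => ⟨(hx t).1.trans (h1 t), h2 t⟩, y', _, hS', fun t => ?_⟩, h1, y',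
      py', hS'⟩
    have := hk (h1 t)
    simp only at this
    linarith
  choose nxt hmono yy hyp hyS using step
  let s : ℕ → {x // Low x} := fun n => nxt^[n] ⟨α, pα, fun t => ⟨le_rfl, hαβ t⟩, yα, fα, hα, hfα⟩
  have hs : ∀ n, s (n + 1) = nxt (s n) := fun n => Function.iterate_succ_apply' _ _ _
  have hsm : ∀ t, Monotone (fun n => (s n).1 t) := fun t => monotone_nat_of_le_succ fun n => by
    rw [hs]; exact hmono _ t
  have hbd : ∀ n t, α t ≤ (s n).1 t ∧ (s n).1 t ≤ β t := fun n t => (s n).2.2.1 t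
  have hlim : ∀ t, ∃ L, Filter.Tendsto (fun n => (s n).1 t) Filter.atTop (nhds L) := fun t =>
    ⟨_, tendsto_atTop_ciSup (hsm t) ⟨β t, by rintro _ ⟨n, rfl⟩; exact (hbd n t).2⟩⟩
  choose X hX using hlim
  have hX1 : ∀ t, Filter.Tendsto (fun n => (s (n + 1)).1 t) Filter.atTop (nhds (X t)) := fun t =>
    (hX t).comp (Filter.tendsto_add_atTop_nat 1)
  obtain ⟨A, hA0, hA⟩ := periodic_bdd hT hα.contx pα
  obtain ⟨B, hB0, hB⟩ := periodic_bdd hT hβ.contx pβ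
  obtain ⟨P, hP0, hP⟩ := periodic_bdd hT cp pp
  set R := A + B with hR
  have hsR : ∀ n t, |(s n).1 t| ≤ R := by
    intro n t
    have h1 := hbd n t
    have h2 := abs_le.1 (hA t)
    have h3 := abs_le.1 (hB t)
    rw [abs_le]; constructor <;> linarith [h1.1, h1.2, h2.1, h2.2, h3.1, h3.2]
  obtain ⟨Q, hQ⟩ := isCompact_Icc.exists_bound_of_continuousOn (s := Icc (-R) R) (f := k)
    ck.continuousOn
  have hcs : ∀ n, Continuous (s n).1 := fun n => by
    obtain ⟨-, -, y, f, hS, -⟩ := (s n).2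
    exact hS.contx
  obtain ⟨Y, pX, pY, hS⟩ := sys_limit (K := P + Q + l * R + l * R) hc ha hT
    (f := fun n t => (p t - k ((s n).1 t) - l * (s n).1 t) + l * (s (n + 1)).1 t)
    (x := fun n => (s (n + 1)).1) (y := fun n => yy (s n)) (F := fun t => p t - k (X t)) (X := X)
    (fun n => by
      have := hyS (s n)
      rw [← hs n] at this
      exact this)
    (fun n => (s (n + 1)).2.1) (fun n => hyp (s n))
    (fun n => by
      have := hcs n
      have := hcs (n + 1)
      fun_prop)
    (fun n t => by
      have h1 := abs_le.1 (hP t)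
      have h2 := abs_le.1 (hQ _ (abs_le.1 (hsR n t)))
      have h3 := abs_le.1 (hsR n t)
      have h4 := abs_le.1 (hsR (n + 1) t)
      have h31 := mul_le_mul_of_nonneg_left h3.1 hl.le
      have h32 := mul_le_mul_of_nonneg_left h3.2 hl.le
      have h41 := mul_le_mul_of_nonneg_left h4.1 hl.le
      have h42 := mul_le_mul_of_nonneg_left h4.2 hl.le
      rw [abs_le]; constructor <;> linarith [h1.1, h1.2, h2.1, h2.2])
    hX1
    (fun t => by
      have h1 := ((((ck.tendsto _).comp (hX t)).const_sub (p t)).sub ((hX t).const_mul l)).add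
        ((hX1 t).const_mul l)
      have e : p t - k (X t) - l * X t + l * X t = p t - k (X t) := by ring
      rw [e] at h1
      exact h1)
    (fun hc => by fun_prop)
  exact ⟨X, Y, pX, pY, fun t => ⟨ge_of_tendsto (hX t) (Filter.Eventually.of_forall fun n =>
    (hbd n t).1), le_of_tendsto (hX t) (Filter.Eventually.of_forall fun n => (hbd n t).2)⟩, hS⟩

lemma sin_add_monotone {b : ℝ} (hb : 0 < b) : Monotone (fun x => b * Real.sin x + b * x) := by
  apply monotone_of_deriv_nonneg (by fun_prop)
  intro x
  have h : HasDerivAt (fun x => b * Real.sin x + b * x) (b * Real.cos x + b * 1) x :=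
    ((Real.hasDerivAt_sin x).const_mul b).add ((hasDerivAt_id x).const_mul b)
  rw [h.deriv]
  have := mul_le_mul_of_nonneg_left (Real.neg_one_le_cos x) hb.le
  linarith

/-- shift so that the value at zero lies in `[0, 2π)` -/
lemma shift_exists (r : ℝ) : ∃ k : ℤ, 0 ≤ r - k * (2 * π) ∧ r - k * (2 * π) < 2 * π := by
  obtain ⟨n, hn, -⟩ := existsUnique_sub_zsmul_mem_Ico Real.two_pi_pos r 0
  simp only [zsmul_eq_mul, zero_add] at hn
  exact ⟨n, hn.1, hn.2⟩

lemma Sys.shift {c a : ℝ} {f x y : ℝ → ℝ} (h : Sys c a f x y) (r : ℝ) :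
    Sys c a f (fun t => x t - r) y := fun t => ⟨(h t).1.sub_const r, (h t).2⟩

lemma Sys.x_bound {c a T R : ℝ} (hc : 0 < c) (hT : 0 < T) {f x y : ℝ → ℝ} (h : Sys c a f x y)
    (px : Function.Periodic x T) (h0 : |x 0| ≤ R) : ∀ t, |x t| ≤ R + c * T := by
  intro t
  obtain ⟨s, hs, hst⟩ := px.exists_mem_Ico₀ hT t
  have h1 := h.lip hc 0 s
  rw [sub_zero, abs_of_nonneg hs.1] at h1
  have h2 := mul_le_mul_of_nonneg_left hs.2.le hc.le
  have h3 := abs_le.1 h0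
  have h4 := abs_le.1 h1
  rw [hst, abs_le]; constructor <;> linarith [h3.1, h3.2, h4.1, h4.2]

lemma solvSet_compactness {c a b T K K' : ℝ} (hc : 0 < c) (ha : 0 < a) (hb : 0 < b) (hT : 0 < T)
    {q : ℕ → ℝ → ℝ} {q₀ : ℝ → ℝ} {s : ℕ → ℝ} (cq : ∀ n, Continuous (q n)) (cq₀ : Continuous q₀)
    (hq : ∀ t, Filter.Tendsto (fun n => q n t) Filter.atTop (nhds (q₀ t)))
    (hK : ∀ n t, |q n t| ≤ K) (hK' : ∀ n, |s n| ≤ K')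
    (hs : ∀ n, s n ∈ solvSet c a b T (q n)) :
    ∃ (φ : ℕ → ℕ) (s₀ : ℝ), StrictMono φ ∧
      Filter.Tendsto (fun n => s (φ n)) Filter.atTop (nhds s₀) ∧ s₀ ∈ solvSet c a b T q₀ := by
  have h1 : ∀ n, ∃ x y, Function.Periodic x T ∧ Function.Periodic y T ∧ |x 0| ≤ 2 * π ∧
      Sys c a (fun t => q n t + s n - b * Real.sin (x t)) x y := by
    intro n
    obtain ⟨x, hx⟩ := hs n
    obtain ⟨y, px, py, hS⟩ := sys_of_isPendSol hc hx
    obtain ⟨k, hk1, hk2⟩ := shift_exists (x 0)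
    refine ⟨fun t => x t - k * (2 * π), y, fun t => by simp only [px t], py, ?_, ?_⟩
    · rw [abs_le]; constructor <;> linarith
    · have := hS.shift (k * (2 * π))
      simp only [Real.sin_sub_int_mul_two_pi]
      exact this
  choose x y px py hx0 hS using h1
  have hxb := fun n => (hS n).x_bound hc hT (px n) (hx0 n)
  obtain ⟨φ, X, hφ, hX⟩ := extract hc (fun n => (hS n).lip hc) hxb
  obtain ⟨s₀, -, ψ, hψ, hs₀⟩ := (isCompact_Icc (a := -K') (b := K')).tendsto_subseq
    (x := fun n => s (φ n)) (fun n => abs_le.1 (hK' (φ n)))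
  have hψt := hψ.tendsto_atTop
  have hφψ := (hφ.comp hψ).tendsto_atTop
  obtain ⟨Y, pX, pY, hXY⟩ := sys_limit (K := K + K' + b) hc ha hT
    (f := fun n t => q (φ (ψ n)) t + s (φ (ψ n)) - b * Real.sin (x (φ (ψ n)) t))
    (F := fun t => q₀ t + s₀ - b * Real.sin (X t)) (X := X)
    (fun n => hS (φ (ψ n))) (fun n => px _) (fun n => py _)
    (fun n => by
      have := cq (φ (ψ n))
      have := (hS (φ (ψ n))).contx
      fun_prop)
    (fun n t => by
      have h1 := abs_le.1 (hK (φ (ψ n)) t)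
      have h2 := abs_le.1 (hK' (φ (ψ n)))
      have h3 := mul_le_mul_of_nonneg_left (Real.neg_one_le_sin (x (φ (ψ n)) t)) hb.le
      have h4 := mul_le_mul_of_nonneg_left (Real.sin_le_one (x (φ (ψ n)) t)) hb.le
      rw [abs_le]; constructor <;> linarith [h1.1, h1.2, h2.1, h2.2])
    (fun t => (hX t).comp hψt)
    (fun t => (((hq t).comp hφψ).add hs₀).sub
      (((Real.continuous_sin.tendsto _).comp ((hX t).comp hψt)).const_mul b))
    (fun hc => by fun_prop)
  exact ⟨φ ∘ ψ, s₀, hφ.comp hψ, hs₀, X, isPendSol_of_sys hc (by fun_prop) pX hXY⟩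

lemma solvSet_bound {c a b T K s : ℝ} (hc : 0 < c) (ha : 0 < a) (hb : 0 < b) (hT : 0 < T)
    {q : ℝ → ℝ} (hK : ∀ t, |q t| ≤ K) (hs : s ∈ solvSet c a b T q) : |s| ≤ K + b + a * c := by
  obtain ⟨x, hx⟩ := hs
  obtain ⟨y, px, py, hS⟩ := sys_of_isPendSol hc hx
  obtain ⟨t, -, hz⟩ := exists_hasDerivAt_eq_zero (f := y) hT
    hS.conty.continuousOn (by have := py 0; rw [zero_add] at this; exact this.symm)
    (fun t _ => (hS t).2)
  have h1 := abs_le.1 (hK t)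
  have h2 := abs_lt.1 (abs_psi_lt hc (y t))
  have h3 := mul_le_mul_of_nonneg_left (Real.neg_one_le_sin (x t)) hb.le
  have h4 := mul_le_mul_of_nonneg_left (Real.sin_le_one (x t)) hb.le
  have h5 := mul_le_mul_of_nonneg_left h2.1.le ha.le
  have h6 := mul_le_mul_of_nonneg_left h2.2.le ha.le
  rw [abs_le]; constructor <;> linarith [h1.1, h1.2]

lemma solvSet_interp {c a b T s₁ s₂ s : ℝ} (hc : 0 < c) (ha : 0 < a) (hb : 0 < b) (hT : 0 < T)
    {q q₀ : ℝ → ℝ} (cq : Continuous q) (pq : Function.Periodic q T)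
    (h₁ : s₁ ∈ solvSet c a b T q₀) (h₂ : s₂ ∈ solvSet c a b T q₀)
    (hle₁ : ∀ t, q₀ t + s₁ ≤ q t + s) (hle₂ : ∀ t, q t + s ≤ q₀ t + s₂) :
    s ∈ solvSet c a b T q := by
  obtain ⟨β, hβ⟩ := h₁
  obtain ⟨α, hα⟩ := h₂
  obtain ⟨yβ, pβ, -, Sβ⟩ := sys_of_isPendSol hc hβ
  obtain ⟨yα, pα, -, Sα⟩ := sys_of_isPendSol hc hα
  obtain ⟨A, hA0, hA⟩ := periodic_bdd hT Sα.contx pα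
  obtain ⟨B, hB0, hB⟩ := periodic_bdd hT Sβ.contx pβ
  obtain ⟨k, hk⟩ := exists_nat_gt ((A + B) / (2 * π))
  rw [div_lt_iff₀ Real.two_pi_pos] at hk
  have Sβ' := Sβ.shift (-(k * (2 * π)))
  obtain ⟨x, y, px, py, -, hS⟩ := upper_lower hc ha hT hb (p := fun t => q t + s)
    (k := fun x => b * Real.sin x) (by fun_prop) (fun t => by simp only [pq t]) (by fun_prop)
    (sin_add_monotone hb) Sα pα (fun t => by linarith [hle₂ t]) Sβ'
    (fun t => by simp only [pβ t])
    (fun t => by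
      simp only [sub_neg_eq_add, Real.sin_add_nat_mul_two_pi]
      linarith [hle₁ t])
    (fun t => by
      have h1 := abs_le.1 (hA t)
      have h2 := abs_le.1 (hB t)
      linarith [h1.2, h2.1])
  exact ⟨x, isPendSol_of_sys hc (by fun_prop) px hS⟩

lemma solvSet_nonempty {c a b T : ℝ} (hc : 0 < c) (ha : 0 < a) (hb : 0 < b) (hT : 0 < T)
    {q : ℝ → ℝ} (cq : Continuous q) (pq : Function.Periodic q T) :
    (solvSet c a b T q).Nonempty := by
  obtain ⟨K, hK0, hK⟩ := periodic_bdd hT cq pq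
  have cst : ∀ m : ℝ, Sys c a (fun _ => 0) (fun _ => m) (fun _ => 0) := by
    intro m t
    refine ⟨?_, ?_⟩
    · rw [psi_zero]; exact hasDerivAt_const _ _
    · rw [psi_zero, mul_zero, sub_zero]; exact hasDerivAt_const _ _
  have hbase : ∀ e : ℝ, 0 < e → e ≤ 1 → ∃ (z : ℝ → ℝ) (s : ℝ), Continuous z ∧
      (∀ t, |z t| ≤ 2 * π + c * T) ∧ |s| ≤ b + K + 2 * π ∧
      s ∈ solvSet c a b T (fun t => q t + e * z t) := by
    intro e he he1
    set M := (b + K) / e with hM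
    have hM0 : 0 < M := by positivity
    have heM : e * M = b + K := by rw [hM]; field_simp
    obtain ⟨x, y, px, py, hx, hS⟩ := upper_lower hc ha hT (l := b + e) (by positivity) (p := q)
      (k := fun x => b * Real.sin x - e * x) cq pq (by fun_prop)
      (by
        have : (fun x => b * Real.sin x - e * x + (b + e) * x)
          = fun x => b * Real.sin x + b * x := by funext x; ring
        rw [this]; exact sin_add_monotone hb)
      (cst (-M)) (fun _ => rfl)
      (fun t => by
        have h1 := abs_le.1 (hK t)
        have h3 := mul_le_mul_of_nonneg_left (Real.neg_one_le_sin (-M)) hb.le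
        rw [mul_neg e M, heM]
        linarith [h1.2])
      (cst M) (fun _ => rfl)
      (fun t => by
        have h1 := abs_le.1 (hK t)
        have h3 := mul_le_mul_of_nonneg_left (Real.sin_le_one M) hb.le
        rw [heM]
        linarith [h1.1])
      (fun t => by linarith)
    obtain ⟨k, hk1, hk2⟩ := shift_exists (x 0)
    have hS' := hS.shift (k * (2 * π))
    have px' : Function.Periodic (fun t => x t - k * (2 * π)) T := fun t => by simp only [px t]
    refine ⟨fun t => x t - k * (2 * π), e * (k * (2 * π)), hS'.contx, ?_, ?_,
      fun t => x t - k * (2 * π), ?_⟩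
    · refine hS'.x_bound hc hT px' ?_
      rw [abs_le]; constructor <;> linarith
    · have h1 := mul_le_mul_of_nonneg_left (hx 0).1 he.le
      have h2 := mul_le_mul_of_nonneg_left (hx 0).2 he.le
      have h3 := mul_nonneg he.le hk1
      have h4 : e * (x 0 - k * (2 * π)) ≤ 1 * (2 * π) :=
        mul_le_mul he1 hk2.le hk1 (by norm_num)
      rw [mul_neg, heM] at h1
      rw [heM] at h2
      rw [mul_sub] at h3 h4
      have := Real.two_pi_pos
      rw [abs_le]; constructor <;> linarith
    · have cx := hS.contx
      refine isPendSol_of_sys (y := y) hc (by fun_prop) px' ?_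
      simp only [Real.sin_sub_int_mul_two_pi]
      convert hS' using 2
      ring
  choose z s cz hz hs hmem using fun n : ℕ => hbase (1 / ((n : ℝ) + 1)) (by positivity) (by
    rw [div_le_one (by positivity)]
    have : (0:ℝ) ≤ n := Nat.cast_nonneg n
    linarith)
  have hcT : 0 < c * T := by positivity
  have h2p := Real.two_pi_pos
  obtain ⟨φ, s₀, -, -, h⟩ := solvSet_compactness (K := K + (2 * π + c * T)) hc ha hb hT
    (q := fun (n : ℕ) t => q t + 1 / ((n : ℝ) + 1) * z n t) (q₀ := q) (s := s)
    (fun n => by have := cz n; fun_prop) cq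
    (fun t => by
      have h1 : Filter.Tendsto (fun n : ℕ => 1 / ((n : ℝ) + 1) * z n t) Filter.atTop (nhds 0) := by
        refine squeeze_zero_norm (a := fun n : ℕ => 1 / ((n : ℝ) + 1) * (2 * π + c * T)) ?_ ?_
        · intro n
          rw [norm_mul, Real.norm_of_nonneg (by positivity)]
          exact mul_le_mul_of_nonneg_left (hz n t) (by positivity)
        · have := (tendsto_one_div_add_atTop_nhds_zero_nat (𝕜 := ℝ)).mul_const (2 * π + c * T)
          simpa using this
      simpa using h1.const_add (q t))
    (fun n t => by
      have h1 : |1 / ((n : ℝ) + 1) * z n t| ≤ 1 * (2 * π + c * T) := by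
        rw [abs_mul, abs_of_pos (by positivity : 0 < 1 / ((n : ℝ) + 1))]
        refine mul_le_mul ?_ (hz n t) (abs_nonneg _) (by norm_num)
        rw [div_le_one (by positivity)]
        have : (0:ℝ) ≤ n := Nat.cast_nonneg n
        linarith
      have := abs_add_le (q t) (1 / ((n : ℝ) + 1) * z n t)
      linarith [hK t])
    hs hmem
  exact ⟨s₀, h⟩

lemma solvSet_isCompact {c a b T : ℝ} (hc : 0 < c) (ha : 0 < a) (hb : 0 < b) (hT : 0 < T)
    {q : ℝ → ℝ} (cq : Continuous q) (pq : Function.Periodic q T) :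
    IsCompact (solvSet c a b T q) := by
  obtain ⟨K, hK0, hK⟩ := periodic_bdd hT cq pq
  apply IsSeqCompact.isCompact
  intro s hs
  obtain ⟨φ, s₀, hφ, h1, h2⟩ := solvSet_compactness hc ha hb hT (q := fun _ => q) (q₀ := q)
    (s := s) (fun _ => cq) cq (fun t => tendsto_const_nhds) (fun _ => hK)
    (fun n => solvSet_bound hc ha hb hT hK (hs n)) hs
  exact ⟨s₀, h2, φ, hφ, h1⟩

/-- the endpoints of the solvability interval depend continuously on the forcing. -/
theorem solvSet_endpoints_continuous (c a b T : ℝ) (hc : 0 < c) (ha : 0 < a) (hb : 0 < b)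
    (hT : 0 < T) (p : ℕ → ℝ → ℝ) (p₀ : ℝ → ℝ)
    (hpcont : ∀ n, Continuous (p n)) (hpper : ∀ n, Function.Periodic (p n) T)
    (hpavg : ∀ n, (∫ t in (0:ℝ)..T, p n t) = 0)
    (hp₀cont : Continuous p₀) (hp₀per : Function.Periodic p₀ T)
    (hp₀avg : (∫ t in (0:ℝ)..T, p₀ t) = 0)
    (hconv : TendstoUniformly p p₀ Filter.atTop) :
    Filter.Tendsto (fun n => sSup (solvSet c a b T (p n))) Filter.atTop
      (nhds (sSup (solvSet c a b T p₀))) ∧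
    Filter.Tendsto (fun n => sInf (solvSet c a b T (p n))) Filter.atTop
      (nhds (sInf (solvSet c a b T p₀))) := by
  obtain ⟨K, hK0, hK⟩ := periodic_bdd hT hp₀cont hp₀per
  have hcpt₀ := solvSet_isCompact hc ha hb hT hp₀cont hp₀per
  have hne₀ := solvSet_nonempty hc ha hb hT hp₀cont hp₀per
  have hcpt := fun n => solvSet_isCompact hc ha hb hT (hpcont n) (hpper n)
  have hne := fun n => solvSet_nonempty hc ha hb hT (hpcont n) (hpper n)
  have huni : ∀ ε > 0, ∀ᶠ n in Filter.atTop, ∀ t, |p₀ t - p n t| < ε := by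
    intro ε hε
    exact Metric.tendstoUniformly_iff.1 hconv ε hε
  have hpt : ∀ t, Filter.Tendsto (fun n => p n t) Filter.atTop (nhds (p₀ t)) :=
    fun t => hconv.tendsto_at t
  -- subsequential limits of selections
  have hsub : ∀ s : ℕ → ℝ, (∀ n, s n ∈ solvSet c a b T (p n)) → ∀ ns : ℕ → ℕ,
      Filter.Tendsto ns Filter.atTop Filter.atTop → ∃ (ms : ℕ → ℕ) (s₀ : ℝ),
        Filter.Tendsto ms Filter.atTop Filter.atTop ∧
        Filter.Tendsto (fun n => s (ns (ms n))) Filter.atTop (nhds s₀) ∧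
        s₀ ∈ solvSet c a b T p₀ := by
    intro s hs ns hns
    obtain ⟨N, hN⟩ := Filter.eventually_atTop.1 (hns.eventually (huni 1 one_pos))
    have hb1 : ∀ n t, |p (ns (n + N)) t| ≤ K + 1 := by
      intro n t
      have h1 := abs_lt.1 (hN (n + N) (Nat.le_add_left _ _) t)
      have h2 := abs_le.1 (hK t)
      rw [abs_le]; constructor <;> linarith [h1.1, h1.2, h2.1, h2.2]
    have hsh := Filter.tendsto_add_atTop_nat N
    obtain ⟨φ, s₀, hφ, h1, h2⟩ := solvSet_compactness hc ha hb hT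
      (q := fun n => p (ns (n + N))) (q₀ := p₀) (s := fun n => s (ns (n + N)))
      (fun n => hpcont _) hp₀cont (fun t => (hpt t).comp (hns.comp hsh)) hb1
      (fun n => solvSet_bound hc ha hb hT (hb1 n) (hs _)) (fun n => hs _)
    exact ⟨fun n => φ n + N, s₀, hsh.comp hφ.tendsto_atTop, h1, h2⟩
  -- interior points persist
  have hpersist : ∀ s₁ s₂ r, s₁ ∈ solvSet c a b T p₀ → s₂ ∈ solvSet c a b T p₀ → s₁ < r → r < s₂ →
      ∀ᶠ n in Filter.atTop, r ∈ solvSet c a b T (p n) := by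
    intro s₁ s₂ r h1 h2 hr1 hr2
    filter_upwards [huni (r - s₁) (by linarith), huni (s₂ - r) (by linarith)] with n hn1 hn2
    exact solvSet_interp hc ha hb hT (hpcont n) (hpper n) h1 h2
      (fun t => by linarith [(abs_lt.1 (hn1 t)).2]) (fun t => by linarith [(abs_lt.1 (hn2 t)).1])
  constructor
  · refine Filter.tendsto_of_subseq_tendsto fun ns hns => ?_
    obtain ⟨ms, s₀, hms, hlim, hs₀⟩ := hsub (fun n => sSup (solvSet c a b T (p n)))
      (fun n => (hcpt n).sSup_mem (hne n)) ns hns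
    refine ⟨ms, ?_⟩
    have hS := hcpt₀.sSup_mem hne₀
    have hle : s₀ ≤ sSup (solvSet c a b T p₀) := le_csSup hcpt₀.bddAbove hs₀
    rcases hle.eq_or_lt with heq | hlt
    · rw [← heq]; exact hlim
    · exfalso
      obtain ⟨r, hr1, hr2⟩ := exists_between hlt
      have h1 := (hns.comp hms).eventually (hpersist _ _ r hs₀ hS hr1 hr2)
      have h2 : r ≤ s₀ := ge_of_tendsto hlim (h1.mono fun n hn =>
        le_csSup (hcpt _).bddAbove hn)
      linarith
  · refine Filter.tendsto_of_subseq_tendsto fun ns hns => ?_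
    obtain ⟨ms, s₀, hms, hlim, hs₀⟩ := hsub (fun n => sInf (solvSet c a b T (p n)))
      (fun n => (hcpt n).sInf_mem (hne n)) ns hns
    refine ⟨ms, ?_⟩
    have hS := hcpt₀.sInf_mem hne₀
    have hle : sInf (solvSet c a b T p₀) ≤ s₀ := csInf_le hcpt₀.bddBelow hs₀
    rcases hle.eq_or_lt with heq | hlt
    · rw [heq]; exact hlim
    · exfalso
      obtain ⟨r, hr1, hr2⟩ := exists_between hlt
      have h1 := (hns.comp hms).eventually (hpersist _ _ r hS hs₀ hr1 hr2)
      have h2 : s₀ ≤ r := le_of_tendsto hlim (h1.mono fun n hn =>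
        csInf_le (hcpt _).bddBelow hn)
      linarith
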